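/- Suppose φ is analytic in a neighborhood of 0 ∈ ℂ, φ(0) = 0, and φ is not identically zero. Let n be a positive integer and suppose there exists ε > 0 such that the map t ↦ (tⁿ, −φ(t)) is injective on {t ∈ ℂ : |t| < ε} and takes no value in ℍ² (i.e., for each |t| < ε, not both Im(tⁿ) > 0 and Im(−φ(t)) > 0). Then exactly one of the following holds: (1) (real stable type) n = 1, all Taylor coefficients of φ at 0 are real, and φ′(0) > 0; (2) (pure stable type) there exist a positive integer L, a polynomial q ∈ ℝ[t] with deg q < 2L, q(0) = 0 and q′(0) > 0, and a function ψ analytic in a neighborhood of 0 with Im ψ(0) > 0, such that φ(t) = q(tⁿ) + t^{2Ln}·ψ(t) for all t in a neighborhood of 0. -/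

import Mathlib

open Complex

open Finset in
/-- Taylor's formula at `0` with an analytic remainder whose value at `0` is the next
coefficient. -/
theorem AnalyticAt.exists_taylor_remainder {f : ℂ → ℂ} (hf : AnalyticAt ℂ f 0) (k : ℕ) :
    ∃ g : ℂ → ℂ, AnalyticAt ℂ g 0 ∧ g 0 = iteratedDeriv k f 0 / k.factorial ∧
      ∀ z, f z = ∑ i ∈ range k, iteratedDeriv i f 0 / i.factorial * z ^ i + z ^ k * g z := by
  obtain ⟨F, hF, h⟩ := hf.exists_eq_sum_add_pow_mul (k + 1)
  refine ⟨fun z => iteratedDeriv k f 0 / k.factorial + z * F z, by fun_prop, by simp, fun z => ?_⟩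
  rw [h z, sum_range_succ]
  simp only [smul_eq_mul]
  rw [sum_congr rfl fun i _ => div_mul_comm (z ^ i) (i.factorial : ℂ) (iteratedDeriv i f 0)]
  ring

/-- If `r ^ k * g (r c) * c ^ k` has nonnegative imaginary part for small `r > 0`, then so does
`g 0 * c ^ k`. -/
theorem im_mul_pow_nonneg_of_eventually {g : ℂ → ℂ} (hg : ContinuousAt g 0) (k : ℕ) (c : ℂ)
    (h : ∀ᶠ r : ℝ in nhdsWithin 0 (Set.Ioi 0), 0 ≤ ((r * c) ^ k * g (r * c)).im) :
    0 ≤ (g 0 * c ^ k).im := by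
  have hcont : ContinuousAt (fun r : ℝ => (g (r * c) * c ^ k).im) 0 := by
    have h1 : ContinuousAt (fun r : ℝ => (r : ℂ) * c) 0 := by fun_prop
    have h2 : ContinuousAt (fun r : ℝ => g (r * c)) 0 :=
      ContinuousAt.comp (g := g) (by simpa using hg) h1
    exact Complex.continuous_im.continuousAt.comp (h2.mul continuousAt_const)
  have ht : Filter.Tendsto (fun r : ℝ => (g (r * c) * c ^ k).im) (nhdsWithin 0 (Set.Ioi 0))
      (nhds (g 0 * c ^ k).im) := by
    simpa using hcont.tendsto.mono_left nhdsWithin_le_nhds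
  refine ge_of_tendsto ht ?_
  filter_upwards [h, self_mem_nhdsWithin] with r hr (hr0 : 0 < r)
  have heq : (r * c) ^ k * g (r * c) = ((r ^ k : ℝ) : ℂ) * (g (r * c) * c ^ k) := by
    push_cast; ring
  rw [heq, Complex.im_ofReal_mul] at hr
  exact nonneg_of_mul_nonneg_right hr (pow_pos hr0 k)

theorem tendsto_ofReal_mul_nhdsGT_zero (c : ℂ) :
    Filter.Tendsto (fun r : ℝ => (r : ℂ) * c) (nhdsWithin 0 (Set.Ioi 0)) (nhds 0) := by
  have h1 : ContinuousAt (fun r : ℝ => (r : ℂ) * c) 0 := by fun_prop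
  simpa using h1.tendsto.mono_left nhdsWithin_le_nhds

/-- If `φ` maps `{0 ≤ Im tⁿ}` to the closed upper half-plane near `0`, then on any ray in that
set the first nonreal term of the Taylor series of `φ` has nonnegative imaginary part. -/
theorem im_taylorCoeff_mul_pow_nonneg {φ : ℂ → ℂ} {n : ℕ} (hφ : AnalyticAt ℂ φ 0)
    (h : ∀ᶠ t in nhds (0 : ℂ), 0 ≤ (t ^ n).im → 0 ≤ (φ t).im) (k : ℕ) (c : ℂ)
    (hc : 0 ≤ (c ^ n).im)
    (hlow : ∀ i < k, (iteratedDeriv i φ 0 / i.factorial * c ^ i).im = 0) :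
    0 ≤ (iteratedDeriv k φ 0 / k.factorial * c ^ k).im := by
  obtain ⟨g, hg, hg0, hsum⟩ := hφ.exists_taylor_remainder k
  rw [← hg0]
  refine im_mul_pow_nonneg_of_eventually hg.continuousAt k c ?_
  filter_upwards [(tendsto_ofReal_mul_nhdsGT_zero c).eventually h, self_mem_nhdsWithin]
    with r hr (hr0 : 0 < r)
  have h1 : 0 ≤ (φ (r * c)).im := by
    apply hr
    rw [mul_pow, ← Complex.ofReal_pow, Complex.im_ofReal_mul]
    positivity
  rw [hsum, Complex.add_im, Complex.im_sum, Finset.sum_eq_zero, zero_add] at h1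
  · exact h1
  · intro i hi
    rw [mul_pow, mul_left_comm, ← Complex.ofReal_pow, Complex.im_ofReal_mul,
      hlow i (Finset.mem_range.mp hi), mul_zero]

/-- The first Taylor coefficient that is neither zero nor real of index divisible by `n`
has index divisible by `2 * n` and positive imaginary part. -/
theorem two_mul_dvd_and_im_taylorCoeff_pos {φ : ℂ → ℂ} {n : ℕ} (hn : 0 < n)
    (hφ : AnalyticAt ℂ φ 0)
    (h : ∀ᶠ t in nhds (0 : ℂ), 0 ≤ (t ^ n).im → 0 ≤ (φ t).im) {k : ℕ} {a : ℕ → ℂ}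
    (ha : ∀ i, a i = iteratedDeriv i φ 0 / i.factorial)
    (hlow : ∀ i < k, a i = 0 ∨ n ∣ i ∧ (a i).im = 0)
    (hk : ¬(a k = 0 ∨ n ∣ k ∧ (a k).im = 0)) :
    2 * n ∣ k ∧ 0 < (a k).im := by
  have key : ∀ c : ℂ, c ^ (2 * n) = 1 → 0 ≤ (a k * c ^ k).im := by
    intro c hc
    have hc' : (c ^ n).im = 0 := by
      have : (c ^ n) ^ 2 = 1 := by rw [← pow_mul, mul_comm n 2, hc]
      rcases sq_eq_sq_iff_eq_or_eq_neg.mp (this.trans (one_pow 2).symm) with h | h <;> simp [h]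
    rw [ha]
    refine im_taylorCoeff_mul_pow_nonneg hφ h k c hc'.ge fun i hi => ?_
    rw [← ha]
    rcases hlow i hi with h0 | ⟨⟨j, rfl⟩, him⟩
    · simp [h0]
    · have hj : ((c ^ n) ^ j).im = 0 := by
        rw [← Complex.conj_eq_iff_im] at hc' ⊢
        rw [map_pow, hc']
      rw [pow_mul, Complex.mul_im, him, hj]
      ring
  push Not at hk
  have h2n : 2 * n ≠ 0 := by positivity
  have hζ := Complex.isPrimitiveRoot_exp (2 * n) h2n
  set ζ := Complex.exp (2 * Real.pi * Complex.I / ((2 * n : ℕ) : ℂ))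
  have h1 : 0 ≤ (a k).im := by simpa using key 1 (by simp)
  by_cases hdvd : 2 * n ∣ k
  · exact ⟨hdvd, lt_of_le_of_ne h1 (Ne.symm (hk.2 (dvd_of_mul_left_dvd hdvd)))⟩
  exfalso
  have hne : ζ ^ k ≠ 1 := fun h => hdvd (hζ.dvd_of_pow_eq_one k h)
  have hsum : ∑ j ∈ Finset.range (2 * n), (a k * (ζ ^ j) ^ k).im = 0 := by
    have : ∑ j ∈ Finset.range (2 * n), (ζ ^ j) ^ k = 0 := by
      simp_rw [← pow_mul, mul_comm _ k, pow_mul]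
      rw [geom_sum_eq hne, ← pow_mul, mul_comm, pow_mul, hζ.pow_eq_one]
      simp
    rw [← Complex.im_sum, ← Finset.mul_sum, this]
    simp
  have hz := (Finset.sum_eq_zero_iff_of_nonneg fun j _ => key (ζ ^ j) (by
    rw [← pow_mul, mul_comm, pow_mul, hζ.pow_eq_one, one_pow])).mp hsum
  have hz0 : (a k).im = 0 := by simpa using hz 0 (by simp [hn])
  have hz1 : (a k * ζ ^ k).im = 0 := by simpa using hz 1 (Finset.mem_range.mpr (by omega))
  rw [Complex.mul_im, hz0, zero_mul, add_zero, mul_eq_zero] at hz1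
  have him : (ζ ^ k).im = 0 := hz1.resolve_left fun hre => hk.1 (Complex.ext hre hz0)
  have hnorm : ‖ζ ^ k‖ = 1 := by rw [norm_pow, hζ.norm'_eq_one h2n, one_pow]
  have hsq : ζ ^ (k * 2) = 1 := by
    rw [pow_mul, sq]
    nth_rewrite 2 [← Complex.conj_eq_iff_im.mpr him]
    rw [Complex.mul_conj, Complex.normSq_eq_norm_sq, hnorm]
    simp
  have hd := hζ.dvd_of_pow_eq_one _ hsq
  rw [mul_comm] at hd
  exact hk.2 (Nat.dvd_of_mul_dvd_mul_right two_pos hd) hz0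

/-- If the lowest nonzero Taylor coefficient has index a positive multiple of `n`, then that
index is `n` and the coefficient is a positive real. -/
theorem eq_and_taylorCoeff_pos {φ : ℂ → ℂ} {n : ℕ} (hn : 0 < n) (hφ : AnalyticAt ℂ φ 0)
    (h : ∀ᶠ t in nhds (0 : ℂ), 0 ≤ (t ^ n).im → 0 ≤ (φ t).im) {m : ℕ} {a : ℕ → ℂ}
    (ha : ∀ i, a i = iteratedDeriv i φ 0 / i.factorial)
    (hlow : ∀ i < m, a i = 0) (hm : a m ≠ 0) (hm0 : m ≠ 0) (hdvd : n ∣ m) :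
    m = n ∧ (a m).im = 0 ∧ 0 < (a m).re := by
  obtain ⟨j, rfl⟩ := hdvd
  have hj : j ≠ 0 := right_ne_zero_of_mul hm0
  have hj0 : (0 : ℝ) < j := by positivity
  have hn0 : (n : ℂ) ≠ 0 := by exact_mod_cast hn.ne'
  have hjC : (j : ℂ) ≠ 0 := by exact_mod_cast hj
  have key : ∀ x : ℝ, 0 ≤ x → x ≤ j * Real.pi →
      0 ≤ (a (n * j)).re * Real.sin x + (a (n * j)).im * Real.cos x := by
    intro x hx0 hx
    have hcn : Complex.exp ((x / j : ℝ) * Complex.I / n) ^ n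
        = Complex.exp ((x / j : ℝ) * Complex.I) := by
      rw [← Complex.exp_nat_mul, mul_div_cancel₀ _ hn0]
    have := im_taylorCoeff_mul_pow_nonneg hφ h (n * j)
      (Complex.exp ((x / j : ℝ) * Complex.I / n)) (by
        rw [hcn, Complex.exp_ofReal_mul_I_im]
        exact Real.sin_nonneg_of_nonneg_of_le_pi (by positivity) (by
          rw [div_le_iff₀ hj0]; linarith)) (fun i hi => by rw [← ha, hlow i hi]; simp)
    rw [← ha, pow_mul, hcn, ← Complex.exp_nat_mul, Complex.mul_im] at this
    have hx' : (j : ℂ) * ((x / j : ℝ) * Complex.I) = x * Complex.I := by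
      push_cast; field_simp
    rwa [hx', Complex.exp_ofReal_mul_I_im, Complex.exp_ofReal_mul_I_re] at this
  have hπ := Real.pi_pos
  have hj1 : (1 : ℝ) ≤ j := by exact_mod_cast Nat.one_le_iff_ne_zero.mpr hj
  have k0 := key 0 le_rfl (by positivity)
  have k1 := key (Real.pi / 2) (by positivity) (by nlinarith)
  have k2 := key Real.pi hπ.le (by nlinarith)
  simp only [Real.sin_zero, Real.cos_zero, Real.sin_pi_div_two, Real.cos_pi_div_two, Real.sin_pi,
    Real.cos_pi] at k0 k1 k2
  have him : (a (n * j)).im = 0 := by linarith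
  have hre : 0 < (a (n * j)).re :=
    lt_of_le_of_ne (by linarith) fun h => hm (Complex.ext h.symm him)
  refine ⟨?_, him, hre⟩
  by_contra hne
  have hj2 : (2 : ℝ) ≤ j := by
    have : j ≠ 1 := fun h => hne (by rw [h, mul_one])
    exact_mod_cast (show 2 ≤ j by omega)
  have k3 := key (Real.pi / 2 + Real.pi) (by positivity) (by nlinarith)
  rw [Real.sin_add_pi, Real.cos_add_pi, Real.sin_pi_div_two, Real.cos_pi_div_two] at k3
  linarith

theorem im_nonneg_of_im_pow_nonneg {φ : ℂ → ℂ} {n : ℕ} (hn : 0 < n) {U : Set ℂ} (hU : IsOpen U)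
    (hφ : ContinuousOn φ U) (h : ∀ t ∈ U, 0 < (t ^ n).im → 0 ≤ (φ t).im) :
    ∀ t ∈ U, 0 ≤ (t ^ n).im → 0 ≤ (φ t).im := by
  intro t ht htn
  have : NeZero n := ⟨hn.ne'⟩
  have hcl : t ∈ closure ((fun z : ℂ => z ^ n) ⁻¹' {z | 0 < z.im}) := by
    rw [← (isOpenQuotientMap_pow n).isOpenMap.preimage_closure_eq_closure_preimage
      (continuous_pow n), Complex.closure_setOfPred_lt_im]
    exact htn
  by_contra! hlt
  have hev := (Complex.continuous_im.continuousAt.comp (hφ.continuousAt (hU.mem_nhds ht))).eventually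
    (gt_mem_nhds hlt)
  obtain ⟨z, hz1, hz2, hz3⟩ :=
    ((mem_closure_iff_frequently.mp hcl).and_eventually (hev.and (hU.mem_nhds ht))).exists
  exact absurd (h z hz3 hz1) (not_le.mpr hz2)

theorem Finset.sum_range_mul_eq_of_dvd {M : Type*} [AddCommMonoid M] (n N : ℕ) (hn : 0 < n)
    (f : ℕ → M) (hf : ∀ i < n * N, ¬ n ∣ i → f i = 0) :
    ∑ i ∈ range (n * N), f i = ∑ j ∈ range N, f (n * j) := by
  rw [← sum_image (s := range N) (g := fun j => n * j) (f := f)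
    fun a _ b _ hab => Nat.eq_of_mul_eq_mul_left hn hab]
  symm
  apply sum_subset
  · intro i hi
    obtain ⟨j, hj, rfl⟩ := mem_image.mp hi
    exact mem_range.mpr (Nat.mul_lt_mul_of_pos_left (mem_range.mp hj) hn)
  · intro i hi hni
    refine hf i (mem_range.mp hi) ?_
    rintro ⟨j, rfl⟩
    exact hni (mem_image_of_mem _ (mem_range.mpr (Nat.lt_of_mul_lt_mul_left (mem_range.mp hi))))

theorem eq_one_of_injOn_of_taylorCoeff_eq_zero {φ : ℂ → ℂ} {n : ℕ} (hn : 0 < n)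
    (hφ : AnalyticAt ℂ φ 0) {U : Set ℂ} (hU : U ∈ nhds 0)
    (hinj : Set.InjOn (fun t : ℂ => (t ^ n, -φ t)) U)
    (hzero : ∀ i, ¬ n ∣ i → iteratedDeriv i φ 0 / i.factorial = 0) : n = 1 := by
  have hζ := Complex.isPrimitiveRoot_exp n hn.ne'
  set ζ := Complex.exp (2 * Real.pi * Complex.I / (n : ℂ))
  have hs := hasFPowerSeriesAt_iff.mp hφ.hasFPowerSeriesAt
  have hmul : Filter.Tendsto (fun t : ℂ => ζ * t) (nhds 0) (nhds 0) := by
    have : ContinuousAt (fun t : ℂ => ζ * t) 0 := by fun_prop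
    simpa using this.tendsto
  have hev : ∀ᶠ t in nhds (0 : ℂ), φ (ζ * t) = φ t ∧ t ∈ U ∧ ζ * t ∈ U := by
    filter_upwards [hs, hmul.eventually hs, hU, hmul.eventually hU] with t h1 h2 h3 h4
    refine ⟨?_, h3, h4⟩
    simp only [FormalMultilinearSeries.coeff_ofScalars, smul_eq_mul, zero_add] at h1 h2
    refine h2.unique (h1.congr_fun fun i => ?_)
    by_cases hi : n ∣ i
    · rw [mul_pow, (hζ.pow_eq_one_iff_dvd i).mpr hi, one_mul]
    · simp [hzero i hi]
  obtain ⟨t, ⟨h1, h2, h3⟩, ht⟩ :=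
    ((hev.filter_mono nhdsWithin_le_nhds).and (self_mem_nhdsWithin (s := {0}ᶜ))).exists
  have := hinj h3 h2 (by simp [mul_pow, hζ.pow_eq_one, h1])
  have h1 : ζ = 1 := mul_right_cancel₀ ht (by rw [this, one_mul])
  exact Nat.dvd_one.mp (hζ.dvd_of_pow_eq_one 1 (by rw [h1, one_pow]))

theorem real_and_pure_stable_type_disjoint {φ : ℂ → ℂ} (hφ : AnalyticAt ℂ φ 0)
    (hreal : ∀ k : ℕ, (iteratedDeriv k φ 0).im = 0) (k : ℕ) (q : Polynomial ℝ) {ψ : ℂ → ℂ}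
    (hψ : AnalyticAt ℂ ψ 0) (hpos : 0 < (ψ 0).im)
    (h : ∀ᶠ t in nhds (0 : ℂ), φ t = (q.map (algebraMap ℝ ℂ)).eval t + t ^ k * ψ t) : False := by
  obtain ⟨g, hg, hg0, hsum⟩ := hφ.exists_taylor_remainder k
  have hcoeff : ∀ i : ℕ, (iteratedDeriv i φ 0 / i.factorial).im = 0 := fun i => by
    rw [Complex.div_natCast_im, hreal, zero_div]
  have := im_mul_pow_nonneg_of_eventually (g := fun t => g t - ψ t)
    (hg.continuousAt.sub hψ.continuousAt) k 1 (by
      filter_upwards [(tendsto_ofReal_mul_nhdsGT_zero 1).eventually h] with r hr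
      rw [mul_one] at hr ⊢
      have h1 : ((r : ℂ) ^ k * (g r - ψ r)) = (q.map (algebraMap ℝ ℂ)).eval (r : ℂ) -
          ∑ i ∈ Finset.range k, iteratedDeriv i φ 0 / i.factorial * (r : ℂ) ^ i := by
        rw [hsum] at hr
        linear_combination hr
      have h2 : ((q.map (algebraMap ℝ ℂ)).eval (r : ℂ)).im = 0 := by
        have : (q.map (algebraMap ℝ ℂ)).eval (r : ℂ) = ((q.eval r : ℝ) : ℂ) :=
          Polynomial.eval_map_algebraMap q (r : ℂ) ▸ Polynomial.aeval_ofReal q r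
        rw [this, Complex.ofReal_im]
      rw [h1, Complex.sub_im, h2, Complex.im_sum, Finset.sum_eq_zero, sub_zero]
      intro i _
      rw [← Complex.ofReal_pow, Complex.im_mul_ofReal, hcoeff, zero_mul])
  rw [one_pow, mul_one, Complex.sub_im, hg0, hcoeff] at this
  linarith

/-- dichotomy for branches of stable polynomials.  If t ↦ (tⁿ, −φ(t)) is
injective near 0 and avoids ℍ², then φ is either of real stable type or pure stable type,
and exactly one of the two occurs. -/
theorem stmt_14 (φ : ℂ → ℂ) (n : ℕ) (hn : 0 < n) (ε : ℝ) (hε : 0 < ε)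
    (hφ : AnalyticOnNhd ℂ φ (Metric.ball 0 ε))
    (h0 : φ 0 = 0)
    (hne : ∃ t ∈ Metric.ball (0 : ℂ) ε, φ t ≠ 0)
    (hinj : Set.InjOn (fun t : ℂ => (t ^ n, -φ t)) (Metric.ball 0 ε))
    (hrange : ∀ t ∈ Metric.ball (0 : ℂ) ε, ¬(0 < (t ^ n).im ∧ 0 < (-φ t).im)) :
    Xor'
      -- (1) real stable type
      (n = 1 ∧ (∀ k : ℕ, (iteratedDeriv k φ 0).im = 0) ∧ 0 < (deriv φ 0).re)
      -- (2) pure stable type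
      (∃ L : ℕ, 0 < L ∧
        ∃ q : Polynomial ℝ, q.natDegree < 2 * L ∧ q.coeff 0 = 0 ∧ 0 < q.coeff 1 ∧
          ∃ ψ : ℂ → ℂ, AnalyticAt ℂ ψ 0 ∧ 0 < (ψ 0).im ∧
            ∀ᶠ t in nhds (0 : ℂ),
              φ t = (q.map (algebraMap ℝ ℂ)).eval (t ^ n) + t ^ (2 * L * n) * ψ t) := by
  have h0mem : (0 : ℂ) ∈ Metric.ball (0 : ℂ) ε := Metric.mem_ball_self hε
  have hU : Metric.ball (0 : ℂ) ε ∈ nhds (0 : ℂ) := Metric.ball_mem_nhds 0 hε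
  have hφ0 : AnalyticAt ℂ φ 0 := hφ 0 h0mem
  have him : ∀ᶠ t in nhds (0 : ℂ), 0 ≤ (t ^ n).im → 0 ≤ (φ t).im := by
    filter_upwards [hU] with t ht
    refine im_nonneg_of_im_pow_nonneg hn Metric.isOpen_ball hφ.continuousOn (fun s hs hsn => ?_) t ht
    by_contra! hneg
    exact hrange s hs ⟨hsn, by simpa using hneg⟩
  obtain ⟨a, ha⟩ : ∃ a : ℕ → ℂ, ∀ i, a i = iteratedDeriv i φ 0 / i.factorial := ⟨_, fun _ => rfl⟩
  have hex : ∃ m, a m ≠ 0 := by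
    by_contra! hall
    obtain ⟨t, ht, hφt⟩ := hne
    refine hφt (hφ.eqOn_zero_of_preconnected_of_eventuallyEq_zero
      (convex_ball 0 ε).isPreconnected h0mem ?_ ht)
    filter_upwards [hasFPowerSeriesAt_iff.mp hφ0.hasFPowerSeriesAt] with z hz
    simp only [FormalMultilinearSeries.coeff_ofScalars, ← ha, hall, smul_zero, zero_add] at hz
    exact hz.unique hasSum_zero
  have ha0 : a 0 = 0 := by simp [ha, h0]
  have hn_coeff : (∀ i, a i ≠ 0 → (∀ l < i, a l = 0) → n ∣ i) → (a n).im = 0 ∧ 0 < (a n).re := by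
    intro hdvd
    classical
    have hm := Nat.find_spec hex
    have hlow : ∀ i < Nat.find hex, a i = 0 := fun i hi => not_not.mp (Nat.find_min hex hi)
    obtain ⟨h1, h2⟩ := eq_and_taylorCoeff_pos hn hφ0 him ha hlow hm
      (fun h => hm (by rw [h, ha0])) (hdvd _ hm hlow)
    rwa [h1] at h2
  refine xor_iff_or_and_not_and _ _ |>.mpr ⟨?_, ?_⟩
  · by_cases hbad : ∃ k, ¬(a k = 0 ∨ n ∣ k ∧ (a k).im = 0)
    · right
      classical
      obtain ⟨k, hk, hlow⟩ : ∃ k, ¬(a k = 0 ∨ n ∣ k ∧ (a k).im = 0) ∧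
          ∀ i < k, a i = 0 ∨ n ∣ i ∧ (a i).im = 0 :=
        ⟨Nat.find hbad, Nat.find_spec hbad, fun i hi => not_not.mp (Nat.find_min hbad hi)⟩
      obtain ⟨⟨L, rfl⟩, hpos⟩ := two_mul_dvd_and_im_taylorCoeff_pos hn hφ0 him ha hlow hk
      rw [show 2 * n * L = n * (2 * L) by ring] at hk hlow hpos
      have hL : 0 < L := Nat.pos_of_ne_zero fun h => by simp [h, ha0] at hpos
      obtain ⟨-, hre⟩ := hn_coeff fun i hi hil => by
        rcases lt_trichotomy i (n * (2 * L)) with h | h | h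
        · exact ((hlow i h).resolve_left hi).1
        · exact ⟨_, h⟩
        · exact absurd (Or.inl (hil _ h)) hk
      obtain ⟨ψ, hψ, hψ0, hsum⟩ := hφ0.exists_taylor_remainder (n * (2 * L))
      have hcoeff : ∀ j, (∑ j ∈ Finset.range (2 * L),
          Polynomial.C (a (n * j)).re * Polynomial.X ^ j).coeff j =
            if j < 2 * L then (a (n * j)).re else 0 := by
        intro j
        simp
      refine ⟨L, hL, ∑ j ∈ Finset.range (2 * L),
        Polynomial.C (a (n * j)).re * Polynomial.X ^ j, ?_, ?_, ?_, ψ, hψ, ?_, ?_⟩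
      · refine lt_of_le_of_lt (Polynomial.natDegree_sum_le_of_forall_le (n := 2 * L - 1) _ _
          fun j hj => (Polynomial.natDegree_C_mul_X_pow_le _ _).trans ?_) (by omega)
        have := Finset.mem_range.mp hj
        omega
      · simp [hcoeff, ha0]
      · rw [hcoeff, if_pos (by omega), mul_one]
        exact hre
      · rwa [hψ0, ← ha]
      · refine Filter.Eventually.of_forall fun t => ?_
        rw [hsum t, show 2 * L * n = n * (2 * L) by ring,
          Finset.sum_range_mul_eq_of_dvd n (2 * L) hn]
        · congr 1
          simp only [Polynomial.eval_map_algebraMap, map_sum, map_mul, map_pow, Polynomial.aeval_X,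
            Polynomial.aeval_C, Complex.coe_algebraMap]
          refine Finset.sum_congr rfl fun j hj => ?_
          have hj' : n * j < n * (2 * L) :=
            Nat.mul_lt_mul_of_pos_left (Finset.mem_range.mp hj) hn
          have hjim : (a (n * j)).im = 0 := by
            rcases hlow _ hj' with h | h
            · simp [h]
            · exact h.2
          rw [← ha, pow_mul, ← Complex.ext (z := ((a (n * j)).re : ℂ)) (w := a (n * j)) rfl
            (by simp [hjim])]
          simp
        · intro i hi hni
          rw [← ha, (hlow i hi).resolve_right fun h => hni h.1, zero_mul]
    · left
      push Not at hbad
      have hn1 : n = 1 := eq_one_of_injOn_of_taylorCoeff_eq_zero hn hφ0 hU hinj fun i hi => by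
        rw [← ha]
        exact (hbad i).resolve_right fun h => hi h.1
      obtain ⟨-, hre⟩ := hn_coeff fun i hi _ => ((hbad i).resolve_left hi).1
      refine ⟨hn1, fun k => ?_, ?_⟩
      · have hk : (a k).im = 0 := by
          rcases hbad k with h | h
          · simp [h]
          · exact h.2
        rw [ha, Complex.div_natCast_im, div_eq_zero_iff] at hk
        exact hk.resolve_right (by exact_mod_cast k.factorial_ne_zero)
      · simpa [hn1, ha, iteratedDeriv_one] using hre
  · rintro ⟨⟨rfl, hreal, -⟩, L, -, q, -, -, -, ψ, hψ, hpos, hev⟩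
    refine real_and_pure_stable_type_disjoint hφ0 hreal (2 * L) q hψ hpos ?_
    simpa using hev
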